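/- Every planar simple graph on 6 vertices that contains no member of Θ₆ as a subgraph (i.e., no subgraph isomorphic to a 6-cycle with a chord between two non-consecutive vertices) has at most 10 edges. -/

import Mathlib

open SimpleGraph

/-- `G` has a planar embedding (drawing in the plane): vertices are mapped to distinct
points of `ℝ²`, each edge `uv` is drawn as a simple continuous arc from the point of `u`
to the point of `v`, arcs traversed in opposite directions coincide, the interior of an
arc passes through no vertex point, and the interiors of arcs of distinct edges are
disjoint. -/
def SimpleGraph.HasPlanarEmbedding {V : Type*} (G : SimpleGraph V) : Prop :=
  ∃ (pos : V → ℝ × ℝ) (arc : V → V → ℝ → ℝ × ℝ),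
    Function.Injective pos ∧
    (∀ u v : V, G.Adj u v →
      ContinuousOn (arc u v) (Set.Icc (0 : ℝ) 1) ∧
      Set.InjOn (arc u v) (Set.Icc (0 : ℝ) 1) ∧
      arc u v 0 = pos u ∧
      arc u v 1 = pos v ∧
      (∀ t : ℝ, arc u v t = arc v u (1 - t)) ∧
      (∀ w : V, ∀ t ∈ Set.Ioo (0 : ℝ) 1, arc u v t ≠ pos w)) ∧
    (∀ u v x y : V, G.Adj u v → G.Adj x y → s(u, v) ≠ s(x, y) →
      ∀ t₁ ∈ Set.Ioo (0 : ℝ) 1, ∀ t₂ ∈ Set.Ioo (0 : ℝ) 1, arc u v t₁ ≠ arc x y t₂)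

/-- `G` contains a subgraph isomorphic to `F`, i.e. there is an injective graph
homomorphism from `F` to `G`. -/
def ContainsCopy {α β : Type*} (F : SimpleGraph α) (G : SimpleGraph β) : Prop :=
  ∃ f : F →g G, Function.Injective f

/-- The Theta graph on 4 vertices: the 4-cycle 0-1-2-3-0 plus the chord 02,
i.e. `K₄` minus one edge. -/
def theta4 : SimpleGraph (Fin 4) :=
  SimpleGraph.fromEdgeSet {s(0, 1), s(1, 2), s(2, 3), s(0, 3), s(0, 2)}

/-- The Theta graph on 5 vertices: the 5-cycle 0-1-2-3-4-0 plus the chord 02. -/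
def theta5 : SimpleGraph (Fin 5) :=
  SimpleGraph.fromEdgeSet {s(0, 1), s(1, 2), s(2, 3), s(3, 4), s(0, 4), s(0, 2)}

/-- The cycle on 6 vertices: 0-1-2-3-4-5-0. -/
def cycle6 : SimpleGraph (Fin 6) :=
  SimpleGraph.fromEdgeSet {s(0, 1), s(1, 2), s(2, 3), s(3, 4), s(4, 5), s(0, 5)}

/-- `G` contains no member of `Θ₆` as a subgraph: for each pair of distinct
non-consecutive vertices `a`, `b` of the 6-cycle, `G` contains no copy of the Theta
graph obtained from the 6-cycle by adding the chord `ab`. -/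
def Theta6Free {β : Type*} (G : SimpleGraph β) : Prop :=
  ∀ a b : Fin 6, a ≠ b → ¬ cycle6.Adj a b →
    ¬ ContainsCopy (cycle6 ⊔ SimpleGraph.fromEdgeSet {s(a, b)}) G

/-- `K₅⁻`: the complete graph on 5 vertices minus one edge. -/
def K5minus : SimpleGraph (Fin 5) :=
  (⊤ : SimpleGraph (Fin 5)).deleteEdges {s(0, 1)}

open Complex in
/-- A nowhere vanishing continuous function on a simply connected space has a logarithm. -/
theorem exists_continuous_exp_eq {A : Type*} [TopologicalSpace A] [SimplyConnectedSpace A]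
    [LocallyPathConnectedSpace A] {f : A → ℂ} (hf : Continuous f) (h0 : ∀ a, f a ≠ 0) :
    ∃ L : A → ℂ, Continuous L ∧ ∀ a, exp (L a) = f a := by
  obtain ⟨a₀⟩ : Nonempty A := inferInstance
  obtain ⟨L, ⟨-, hL⟩, -⟩ := isCoveringMapOn_exp.existsUnique_continuousMap_lifts ⟨f, hf⟩
    (a₀ := a₀) (e₀ := log (f a₀)) (exp_log (h0 a₀)) h0
  exact ⟨L, L.continuous, fun a => congrFun hL a⟩

/-- The increment over `[0, 1]` of a continuous logarithm of a curve. -/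
noncomputable def logIncrement (γ : ℝ → ℂ) : ℂ :=
  open Classical in
  if h : ∃ L : ℝ → ℂ, Continuous L ∧ ∀ t, Complex.exp (L t) = γ t then
    h.choose 1 - h.choose 0 else 0

theorem logIncrement_eq {γ L : ℝ → ℂ} (hL : Continuous L) (h : ∀ t, Complex.exp (L t) = γ t) :
    logIncrement γ = L 1 - L 0 := by
  have hex : ∃ L : ℝ → ℂ, Continuous L ∧ ∀ t, Complex.exp (L t) = γ t := ⟨L, hL, h⟩
  rw [logIncrement, dif_pos hex]
  obtain ⟨hM, hM'⟩ := hex.choose_spec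
  set M := hex.choose
  have hγ : Continuous γ := by
    rw [← funext h]; exact Complex.continuous_exp.comp hL
  have huniq := (Complex.isCoveringMapOn_exp.existsUnique_continuousMap_lifts (A := ℝ) ⟨γ, hγ⟩
    (a₀ := 0) (h 0) fun a => by
      change γ a ≠ 0; rw [← h]; exact Complex.exp_ne_zero _).unique
    (y₁ := ⟨L, hL⟩) (y₂ := ⟨fun t => M t + (L 0 - M 0), by fun_prop⟩)
    ⟨rfl, funext h⟩
    ⟨by simp, funext fun t => by
      have hne : γ 0 ≠ 0 := h 0 ▸ Complex.exp_ne_zero _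
      simp [Complex.exp_add, Complex.exp_sub, hM', h, hne]⟩
  have h1 := DFunLike.congr_fun huniq 1
  simp only [ContinuousMap.coe_mk] at h1
  rw [h1]; ring

theorem exp_logIncrement {γ : ℝ → ℂ} (hγ : Continuous γ) (h0 : ∀ t, γ t ≠ 0) :
    Complex.exp (logIncrement γ) = γ 1 / γ 0 := by
  obtain ⟨L, hL, h⟩ := exists_continuous_exp_eq hγ h0
  rw [logIncrement_eq hL h, Complex.exp_sub, h, h]

theorem logIncrement_neg {γ : ℝ → ℂ} (hγ : Continuous γ) (h0 : ∀ t, γ t ≠ 0) :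
    logIncrement (fun t => -γ t) = logIncrement γ := by
  obtain ⟨L, hL, h⟩ := exists_continuous_exp_eq hγ h0
  rw [logIncrement_eq hL h, logIncrement_eq (L := fun t => L t + Real.pi * Complex.I) (by fun_prop)]
  · ring
  · intro t; simp [Complex.exp_add, h]

/-- The difference of two disjoint curves has no monodromy around the boundary of the parameter
square. -/
theorem logIncrement_square {γ δ : ℝ → ℂ} (hγ : Continuous γ) (hδ : Continuous δ)
    (hne : ∀ s t, γ s ≠ δ t) :
    logIncrement (fun s => γ s - δ 0) + logIncrement (fun t => δ t - γ 1) =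
      logIncrement (fun t => δ t - γ 0) + logIncrement (fun s => γ s - δ 1) := by
  obtain ⟨L, hL, h⟩ := exists_continuous_exp_eq (A := ℝ × ℝ) (f := fun x => γ x.1 - δ x.2)
    (by fun_prop) (fun x => sub_ne_zero.2 (hne _ _))
  have key (s : ℝ) : logIncrement (fun t => δ t - γ s) = L (s, 1) - L (s, 0) := by
    have := logIncrement_neg (γ := fun t => γ s - δ t) (by fun_prop)
      fun t => sub_ne_zero.2 (hne s t)
    simp only [neg_sub] at this
    rw [this, logIncrement_eq (L := fun t => L (s, t)) (by fun_prop) fun t => h (s, t)]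
  have key' (t : ℝ) : logIncrement (fun s => γ s - δ t) = L (1, t) - L (0, t) :=
    logIncrement_eq (L := fun s => L (s, t)) (by fun_prop) fun s => h (s, t)
  rw [key, key, key', key']
  ring

open Complex in
/-- Nonplanarity of `K₅`, in a form that allows adjacent edges to cross: disjoint edges of `K₅`
cannot all be drawn disjointly in the plane. -/
theorem not_exists_disjoint_drawing_K5 (p : Fin 5 → ℂ) (hp : Function.Injective p)
    (e : Fin 5 → Fin 5 → ℝ → ℂ)
    (hcont : ∀ a b, a < b → Continuous (e a b))
    (hzero : ∀ a b, a < b → e a b 0 = p a) (hone : ∀ a b, a < b → e a b 1 = p b)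
    (hvertex : ∀ a b v, a < b → v ≠ a → v ≠ b → ∀ t, e a b t ≠ p v)
    (hedge : ∀ a b c d, a < b → c < d → a ≠ c → a ≠ d → b ≠ c → b ≠ d →
      ∀ s t, e a b s ≠ e c d t) : False := by
  let θ : Fin 5 → Fin 5 → ℂ := fun v w =>
    if v < w then log (p w - p v) else log (p v - p w) + Real.pi * I
  have hθ (v w) (h : v ≠ w) : exp (θ v w) = p w - p v := by
    by_cases hlt : v < w
    · simp only [θ, if_pos hlt]
      exact exp_log (sub_ne_zero.2 (hp.ne h.symm))
    · simp only [θ, if_neg hlt, exp_add, exp_pi_mul_I, exp_log (sub_ne_zero.2 (hp.ne h))]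
      ring
  let ε : Fin 5 → Fin 5 → ℤ := fun v w => if v < w then -1 else 1
  have hε (v w) (h : v ≠ w) : θ v w - θ w v = ε v w * (Real.pi * I) := by
    rcases lt_or_gt_of_ne h with hlt | hlt <;> simp [θ, ε, hlt, hlt.not_gt]
  have hn (v a b) : ∃ n : ℤ, a < b → v ≠ a → v ≠ b →
      logIncrement (fun t => e a b t - p v) = θ v b - θ v a + n * (2 * Real.pi * I) := by
    by_cases H : a < b ∧ v ≠ a ∧ v ≠ b
    · obtain ⟨hab, hva, hvb⟩ := H
      have := exp_logIncrement (γ := fun t => e a b t - p v) ((hcont a b hab).sub continuous_const)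
        fun t => sub_ne_zero.2 (hvertex a b v hab hva hvb t)
      rw [hzero a b hab, hone a b hab, ← hθ v a hva, ← hθ v b hvb, ← exp_sub,
        exp_eq_exp_iff_exists_int] at this
      exact this.imp fun n hn _ _ _ => hn
    · exact ⟨0, fun h1 h2 h3 => (H ⟨h1, h2, h3⟩).elim⟩
  choose n hn using hn
  have rel (a b c d) (hab : a < b) (hcd : c < d) (hac : a ≠ c) (had : a ≠ d) (hbc : b ≠ c)
      (hbd : b ≠ d) : ε c b - ε c a - ε d b + ε d a +
        2 * (n c a b - n d a b + n b c d - n a c d) = 0 := by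
    have := logIncrement_square (hcont a b hab) (hcont c d hcd)
      (hedge a b c d hab hcd hac had hbc hbd)
    rw [hzero a b hab, hone a b hab, hzero c d hcd, hone c d hcd,
      hn c a b hab hac.symm hbc.symm, hn d a b hab had.symm hbd.symm,
      hn a c d hcd hac had, hn b c d hcd hbc hbd] at this
    have hpi : (Real.pi * I : ℂ) ≠ 0 := by simp [Real.pi_ne_zero]
    have h2 : ((ε c b - ε c a - ε d b + ε d a +
        2 * (n c a b - n d a b + n b c d - n a c d) : ℤ) : ℂ) * (Real.pi * I) = 0 := by
      push_cast
      linear_combination this - hε c b hbc.symm + hε c a hac.symm + hε d b hbd.symm -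
        hε d a had.symm
    exact_mod_cast (mul_eq_zero.1 h2).resolve_right hpi
  have r1 := rel 0 1 2 3 (by decide) (by decide) (by decide) (by decide) (by decide) (by decide)
  have r2 := rel 0 2 1 3 (by decide) (by decide) (by decide) (by decide) (by decide) (by decide)
  have r3 := rel 0 3 1 2 (by decide) (by decide) (by decide) (by decide) (by decide) (by decide)
  have r4 := rel 0 1 2 4 (by decide) (by decide) (by decide) (by decide) (by decide) (by decide)
  have r5 := rel 0 2 1 4 (by decide) (by decide) (by decide) (by decide) (by decide) (by decide)
  have r6 := rel 0 4 1 2 (by decide) (by decide) (by decide) (by decide) (by decide) (by decide)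
  have r7 := rel 0 1 3 4 (by decide) (by decide) (by decide) (by decide) (by decide) (by decide)
  have r8 := rel 0 3 1 4 (by decide) (by decide) (by decide) (by decide) (by decide) (by decide)
  have r9 := rel 0 4 1 3 (by decide) (by decide) (by decide) (by decide) (by decide) (by decide)
  have r10 := rel 0 2 3 4 (by decide) (by decide) (by decide) (by decide) (by decide) (by decide)
  have r11 := rel 0 3 2 4 (by decide) (by decide) (by decide) (by decide) (by decide) (by decide)
  have r12 := rel 0 4 2 3 (by decide) (by decide) (by decide) (by decide) (by decide) (by decide)
  have r13 := rel 1 2 3 4 (by decide) (by decide) (by decide) (by decide) (by decide) (by decide)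
  have r14 := rel 1 3 2 4 (by decide) (by decide) (by decide) (by decide) (by decide) (by decide)
  have r15 := rel 1 4 2 3 (by decide) (by decide) (by decide) (by decide) (by decide) (by decide)
  simp only [ε, Fin.reduceLT, if_true, if_false]
    at r1 r2 r3 r4 r5 r6 r7 r8 r9 r10 r11 r12 r13 r14 r15
  omega

/-- `P` holds of every list obtained by prepending at most `k` elements of `l`, in reverse order,
to `acc`. -/
def allShortSublists {α : Type*} (P : List α → Bool) : ℕ → List α → List α → Bool
  | 0, _, acc => P acc
  | _ + 1, [], acc => P acc
  | k + 1, x :: xs, acc =>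
    allShortSublists P k xs (x :: acc) && allShortSublists P (k + 1) xs acc

theorem apply_of_allShortSublists {α : Type*} {P : List α → Bool} {k : ℕ} {l acc s : List α}
    (h : allShortSublists P k l acc = true) (hs : s.Sublist l) (hk : s.length ≤ k) :
    P (s.reverse ++ acc) = true := by
  induction hs generalizing k acc with
  | slnil => cases k <;> simpa [allShortSublists] using h
  | @cons s l x hs ih =>
    cases k with
    | zero =>
      obtain rfl : s = [] := List.length_eq_zero_iff.1 (Nat.le_zero.1 hk)
      simpa [allShortSublists] using h
    | succ k =>
      rw [allShortSublists, Bool.and_eq_true] at h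
      exact ih h.2 hk
  | @cons_cons s l x hs ih =>
    cases k with
    | zero => simp at hk
    | succ k =>
      rw [allShortSublists, Bool.and_eq_true] at h
      simpa using ih h.1 (by simpa using hk)

/-- The list of pairs `q` of elements of `Fin 6` with `q.1 < q.2`. -/
def pairsFin6 : List (Fin 6 × Fin 6) :=
  [(0, 1), (0, 2), (0, 3), (0, 4), (0, 5), (1, 2), (1, 3), (1, 4), (1, 5), (2, 3), (2, 4), (2, 5),
    (3, 4), (3, 5), (4, 5)]

/-- Adjacency in the graph on `Fin 6` whose non-edges are listed in `s`. -/
def adjOfNonEdges (s : List (Fin 6 × Fin 6)) (x y : Fin 6) : Bool :=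
  !(x == y) && s.all fun q => !((q.1 == x && q.2 == y) || (q.1 == y && q.2 == x))

/-- All pairs in `s` have a common element, or the graph with non-edges `s` has a Hamiltonian
cycle. -/
def starOrHamiltonian (s : List (Fin 6 × Fin 6)) : Bool :=
  ([0, 1, 2, 3, 4, 5].any fun v : Fin 6 => s.all fun q => q.1 == v || q.2 == v) ||
  [1, 2, 3, 4, 5].any fun a : Fin 6 => adjOfNonEdges s 0 a &&
  [1, 2, 3, 4, 5].any fun b : Fin 6 => !(a == b) && adjOfNonEdges s a b &&
  [1, 2, 3, 4, 5].any fun c : Fin 6 => !(a == c || b == c) && adjOfNonEdges s b c &&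
  [1, 2, 3, 4, 5].any fun d : Fin 6 => !(a == d || b == d || c == d) && adjOfNonEdges s c d &&
  [1, 2, 3, 4, 5].any fun e : Fin 6 => !(a == e || b == e || c == e || d == e) &&
    adjOfNonEdges s d e && adjOfNonEdges s e 0

theorem starOrHamiltonian_of_length_le_four {s : List (Fin 6 × Fin 6)}
    (hs : s.Sublist pairsFin6) (h4 : s.length ≤ 4) : starOrHamiltonian s.reverse = true := by
  have h : allShortSublists starOrHamiltonian 4 pairsFin6 [] = true := by decide +kernel
  simpa using apply_of_allShortSublists h hs h4

theorem star_or_hamiltonian_of_starOrHamiltonian {s : List (Fin 6 × Fin 6)}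
    (h : starOrHamiltonian s = true) :
    (∃ v, ∀ q ∈ s, q.1 = v ∨ q.2 = v) ∨
      ∃ c : Fin 6 → Fin 6, Function.Injective c ∧
        ∀ x y, cycle6.Adj x y → (c x, c y) ∉ s ∧ (c y, c x) ∉ s := by
  have hadj (x y : Fin 6) (h : adjOfNonEdges s x y = true) :
      x ≠ y ∧ (x, y) ∉ s ∧ (y, x) ∉ s := by
    simp only [adjOfNonEdges, Bool.and_eq_true, Bool.not_eq_true', beq_eq_false_iff_ne,
      List.all_eq_true] at h
    exact ⟨h.1, fun hm => by simpa using h.2 _ hm, fun hm => by simpa using h.2 _ hm⟩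
  simp only [starOrHamiltonian, Bool.or_eq_true, List.any_eq_true, Bool.and_eq_true,
    Bool.not_eq_true', Bool.or_eq_false_iff, beq_eq_false_iff_ne, List.all_eq_true,
    beq_iff_eq] at h
  refine h.imp (fun ⟨v, _, hv⟩ => ⟨v, hv⟩) ?_
  rintro ⟨a, ha, h0a, b, hb, ⟨hab, hab'⟩, c, hc, ⟨⟨hac, hbc⟩, hbc'⟩, d, hd,
    ⟨⟨⟨had, hbd⟩, hcd⟩, hcd'⟩, e, he, ⟨⟨⟨⟨hae, hbe⟩, hce⟩, hde⟩, hde'⟩, he0⟩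
  have hne (x : Fin 6) (hx : x ∈ [1, 2, 3, 4, 5]) : 0 ≠ x := by
    rintro rfl; revert hx; decide
  refine ⟨![0, a, b, c, d, e], ?_, ?_⟩
  · rw [← List.nodup_ofFn]
    simp [hne, ha, hb, hc, hd, he, hab, hac, hbc, had, hbd, hcd, hae, hbe, hce, hde]
  · have h1 := (hadj _ _ h0a).2
    have h2 := (hadj _ _ hab').2
    have h3 := (hadj _ _ hbc').2
    have h4 := (hadj _ _ hcd').2
    have h5 := (hadj _ _ hde').2
    have h6 := (hadj _ _ he0).2
    intro x y hxy
    simp only [cycle6, fromEdgeSet_adj, Set.mem_insert_iff, Set.mem_singleton_iff, Sym2.eq_iff]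
      at hxy
    rcases hxy.1 with h | h | h | h | h | h <;> rcases h with ⟨rfl, rfl⟩ | ⟨rfl, rfl⟩
    exacts [h1, h1.symm, h2, h2.symm, h3, h3.symm, h4, h4.symm, h5, h5.symm, h6.symm, h6]

/-- A graph on six vertices with at least eleven edges contains `K₅` or is Hamiltonian. -/
theorem exists_K5_or_hamiltonian {V : Type*} [Fintype V] (G : SimpleGraph V)
    (hcard : Fintype.card V = 6) (hE : 11 ≤ G.edgeSet.ncard) :
    (∃ φ : Fin 5 → V, Function.Injective φ ∧ ∀ a b, a ≠ b → G.Adj (φ a) (φ b)) ∨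
      ∃ f : cycle6 →g G, Function.Bijective f := by
  classical
  let g : Fin 6 ≃ V := (Fintype.equivFinOfCardEq hcard).symm
  have hmem (x y : Fin 6) (h : x ≠ y) : (x, y) ∈ pairsFin6 ∨ (y, x) ∈ pairsFin6 := by
    revert x y; decide
  let A := pairsFin6.filter fun q => G.Adj (g q.1) (g q.2)
  let N := pairsFin6.filter fun q => ¬ G.Adj (g q.1) (g q.2)
  have hA : 11 ≤ A.length := by
    have hsub : G.edgeSet ⊆ ((A.map fun q => s(g q.1, g q.2)).toFinset : Set (Sym2 V)) := by
      intro z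
      induction z with | h u v =>
      intro huv
      rw [mem_edgeSet] at huv
      simp only [List.coe_toFinset, List.mem_map, Set.mem_ofPred_eq, A, List.mem_filter,
        decide_eq_true_eq]
      rcases hmem (g.symm u) (g.symm v) (by simpa using huv.ne) with h | h
      · exact ⟨_, ⟨h, by simpa using huv⟩, by simp⟩
      · exact ⟨_, ⟨h, by simpa using huv.symm⟩, by simp⟩
    calc 11 ≤ G.edgeSet.ncard := hE
      _ ≤ _ := Set.ncard_le_ncard hsub (Finset.finite_toSet _)
      _ ≤ A.length := by
        rw [Set.ncard_coe_finset]
        simpa using List.toFinset_card_le (A.map fun q => s(g q.1, g q.2))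
  have hN : N.length ≤ 4 := by
    have : pairsFin6.length = A.length + N.length := by
      simpa [A, N] using List.length_eq_length_filter_add (l := pairsFin6)
        fun q => decide (G.Adj (g q.1) (g q.2))
    have : pairsFin6.length = 15 := rfl
    omega
  have hadj (x y : Fin 6) (hne : x ≠ y) (h1 : (x, y) ∉ N) (h2 : (y, x) ∉ N) :
      G.Adj (g x) (g y) := by
    by_contra hG
    rcases hmem x y hne with h | h
    · exact h1 (by simp [N, h, hG])
    · exact h2 (by simp [N, h, G.adj_comm (g y), hG])
  rcases star_or_hamiltonian_of_starOrHamiltonian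
      (starOrHamiltonian_of_length_le_four List.filter_sublist hN) with ⟨v, hv⟩ | ⟨c, hc, hc'⟩
  · have hv' (q : Fin 6 × Fin 6) (h1 : q.1 ≠ v) (h2 : q.2 ≠ v) : q ∉ N := fun h =>
      (hv q (List.mem_reverse.2 h)).elim h1 h2
    exact Or.inl ⟨fun a => g (v.succAbove a), g.injective.comp Fin.succAbove_right_injective,
      fun a b hab => hadj _ _ (Fin.succAbove_right_injective.ne hab)
        (hv' _ (Fin.succAbove_ne _ _) (Fin.succAbove_ne _ _))
        (hv' _ (Fin.succAbove_ne _ _) (Fin.succAbove_ne _ _))⟩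
  · simp only [List.mem_reverse] at hc'
    exact Or.inr ⟨⟨fun x => g (c x), fun {x y} h =>
      hadj _ _ (hc.ne h.ne) (hc' x y h).1 (hc' x y h).2⟩,
      g.bijective.comp (Finite.injective_iff_bijective.1 hc)⟩

/-- A Hamiltonian graph on six vertices with at least seven edges contains a member of `Θ₆`. -/
theorem Theta6Free.ncard_edgeSet_le {V : Type*} {G : SimpleGraph V} (hfree : Theta6Free G)
    (f : cycle6 →g G) (hf : Function.Bijective f) : G.edgeSet.ncard ≤ 6 := by
  classical
  have hchord (a b : Fin 6) (hab : G.Adj (f a) (f b)) : cycle6.Adj a b := by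
    by_contra hcyc
    refine hfree a b (fun h => hab.ne (congrArg f h)) hcyc ⟨⟨f, fun {x y} hxy => ?_⟩, hf.1⟩
    rcases hxy with hxy | hxy
    · exact f.map_rel hxy
    · rw [fromEdgeSet_adj, Set.mem_singleton_iff, Sym2.eq_iff] at hxy
      rcases hxy.1 with ⟨rfl, rfl⟩ | ⟨rfl, rfl⟩
      · exact hab
      · exact hab.symm
  let E : Finset (Sym2 (Fin 6)) := {s(0, 1), s(1, 2), s(2, 3), s(3, 4), s(4, 5), s(0, 5)}
  have hsub : G.edgeSet ⊆ (E.image (Sym2.map f) : Finset (Sym2 V)) := by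
    intro z
    induction z with | h u v =>
    intro huv
    obtain ⟨a, rfl⟩ := hf.2 u
    obtain ⟨b, rfl⟩ := hf.2 v
    have := hchord a b huv
    rw [cycle6, fromEdgeSet_adj] at this
    exact Finset.mem_coe.2 (Finset.mem_image.2 ⟨s(a, b), by simpa [E] using this.1, rfl⟩)
  calc G.edgeSet.ncard ≤ _ := Set.ncard_le_ncard hsub (Finset.finite_toSet _)
    _ ≤ E.card := by rw [Set.ncard_coe_finset]; exact Finset.card_image_le
    _ ≤ 6 := Finset.card_le_six

/-- A planar graph does not contain `K₅`. -/
theorem SimpleGraph.HasPlanarEmbedding.not_exists_K5 {V : Type*} {G : SimpleGraph V}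
    (h : G.HasPlanarEmbedding) (φ : Fin 5 → V) (hφ : Function.Injective φ)
    (hadj : ∀ a b, a ≠ b → G.Adj (φ a) (φ b)) : False := by
  obtain ⟨pos, arc, hpos, harc, hdisj⟩ := h
  let τ : (ℝ × ℝ) ≃L[ℝ] ℂ := Complex.equivRealProdCLM.symm
  let clamp (t : ℝ) : ℝ := Set.projIcc 0 1 zero_le_one t
  have hclamp (t : ℝ) : clamp t ∈ Set.Icc (0 : ℝ) 1 := (Set.projIcc 0 1 zero_le_one t).2
  have hclamp_cont : Continuous clamp := continuous_subtype_val.comp continuous_projIcc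
  have hvertex (u v w : V) (huv : G.Adj u v) (hwu : w ≠ u) (hwv : w ≠ v) (t : ℝ)
      (ht : t ∈ Set.Icc (0 : ℝ) 1) : arc u v t ≠ pos w := by
    obtain ⟨-, -, h0, h1, -, h⟩ := harc u v huv
    rcases Set.eq_endpoints_or_mem_Ioo_of_mem_Icc ht with rfl | rfl | ht
    · rw [h0]; exact hpos.ne hwu.symm
    · rw [h1]; exact hpos.ne hwv.symm
    · exact h w t ht
  have hedge (u v x y : V) (huv : G.Adj u v) (hxy : G.Adj x y) (hux : u ≠ x) (huy : u ≠ y)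
      (hvx : v ≠ x) (hvy : v ≠ y) (s t : ℝ) (hs : s ∈ Set.Icc (0 : ℝ) 1)
      (ht : t ∈ Set.Icc (0 : ℝ) 1) : arc u v s ≠ arc x y t := by
    obtain ⟨-, -, h0, h1, -, -⟩ := harc u v huv
    obtain ⟨-, -, h0', h1', -, -⟩ := harc x y hxy
    rcases Set.eq_endpoints_or_mem_Ioo_of_mem_Icc hs with rfl | rfl | hs'
    · rw [h0]; exact (hvertex x y u hxy hux huy t ht).symm
    · rw [h1]; exact (hvertex x y v hxy hvx hvy t ht).symm
    rcases Set.eq_endpoints_or_mem_Ioo_of_mem_Icc ht with rfl | rfl | ht'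
    · rw [h0']; exact hvertex u v x huv hux.symm hvx.symm s hs
    · rw [h1']; exact hvertex u v y huv huy.symm hvy.symm s hs
    · exact hdisj u v x y huv hxy (by simp [hux, huy]) s hs' t ht'
  refine not_exists_disjoint_drawing_K5 (fun a => τ (pos (φ a)))
    (τ.injective.comp (hpos.comp hφ)) (fun a b t => τ (arc (φ a) (φ b) (clamp t))) ?_ ?_ ?_ ?_ ?_
  · intro a b hab
    exact τ.continuous.comp
      ((harc _ _ (hadj a b hab.ne)).1.comp_continuous hclamp_cont hclamp)
  · intro a b hab
    simp [clamp, (harc _ _ (hadj a b hab.ne)).2.2.1]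
  · intro a b hab
    simp [clamp, (harc _ _ (hadj a b hab.ne)).2.2.2.1]
  · intro a b v hab hva hvb t
    exact τ.injective.ne
      (hvertex _ _ _ (hadj a b hab.ne) (hφ.ne hva) (hφ.ne hvb) _ (hclamp t))
  · intro a b c d hab hcd hac had hbc hbd s t
    exact τ.injective.ne (hedge _ _ _ _ (hadj a b hab.ne) (hadj c d hcd.ne) (hφ.ne hac)
      (hφ.ne had) (hφ.ne hbc) (hφ.ne hbd) _ _ (hclamp s) (hclamp t))

/-- Every planar simple graph on 6 vertices containing no member of `Θ₆` as a subgraph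
has at most 10 edges. -/
theorem theta6_free_six_vertices
    (V : Type*) [Fintype V] (G : SimpleGraph V) (hcard : Fintype.card V = 6)
    (hplanar : G.HasPlanarEmbedding) (hfree : Theta6Free G) :
    G.edgeSet.ncard ≤ 10 := by
  by_contra! hE
  rcases exists_K5_or_hamiltonian G hcard hE with ⟨φ, hφ, hadj⟩ | ⟨f, hf⟩
  · exact hplanar.not_exists_K5 φ hφ hadj
  · exact absurd (hfree.ncard_edgeSet_le f hf) (by omega)
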